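/- arXiv:2311.07790 — 2 statements merged into one kernel-verified Lean document; each statement's English description precedes it below -/
import Mathlib

section
/- Let H : [0,∞) × ℝ^n → ℝ be continuous with p ↦ H(t,p) convex for each t ≥ 0, let J : ℝ^n → ℝ be convex, and define S(x,t) = sup_{p ∈ ℝ^n} { ⟨x,p⟩ − ∫₀ᵗ H(s,p) ds − J*(p) }; assume S(x,t) is finite for all (x,t) ∈ ℝ^n × [0,∞). Let t₀ > 0, x₀ ∈ ℝ^n, and suppose (p,q) ∈ ℝ^n × ℝ satisfies S(x,t) ≥ S(x₀,t₀) + ⟨p, x − x₀⟩ + q(t − t₀) for all (x,t) ∈ ℝ^n × [0,∞). Then q + H(t₀, p) ≥ 0; that is, S is a viscosity supersolution of the Hamilton–Jacobi equation ∂_t S + H(t, ∇_x S) = 0 in the subdifferential sense. -/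
open scoped RealInnerProductSpace

/-- The Fenchel–Legendre transform of an `EReal`-valued function on `ℝ^n`,
`f*(p) = sup_x (⟨x,p⟩ - f(x))`, valued in `ℝ ∪ {+∞}` (here `EReal`). -/
noncomputable def fenchel {n : ℕ} (f : EuclideanSpace ℝ (Fin n) → EReal)
    (p : EuclideanSpace ℝ (Fin n)) : EReal :=
  ⨆ x : EuclideanSpace ℝ (Fin n), ((⟪x, p⟫ : ℝ) : EReal) - f x

/-- Fenchel–Moreau in epigraph form: a closed convex upward closed subset of `E × ℝ` whose
conjugate `S` is finite contains every point `(p, c)` above all its affine minorants. -/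
theorem mem_of_forall_inner_sub_conjugate_le {E : Type*} [NormedAddCommGroup E]
    [InnerProductSpace ℝ E] [CompleteSpace E] {s : Set (E × ℝ)} (hconv : Convex ℝ s)
    (hclosed : IsClosed s) (hup : ∀ p r r', (p, r) ∈ s → r ≤ r' → (p, r') ∈ s) {S : E → ℝ}
    (hS : ∀ x, IsLUB ((fun z : E × ℝ => ⟪x, z.1⟫ - z.2) '' s) (S x)) {p : E} {c : ℝ}
    (h : ∀ x, ⟪x, p⟫ - S x ≤ c) : (p, c) ∈ s := by
  by_contra hpc
  obtain ⟨f, u, hfu, hus⟩ := geometric_hahn_banach_point_closed hconv hclosed hpc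
  set y : E := (InnerProductSpace.toDual ℝ E).symm (f.comp (ContinuousLinearMap.inl ℝ E ℝ))
  set β : ℝ := f (0, 1)
  have hf : ∀ a r, f (a, r) = ⟪y, a⟫ + β * r := by
    intro a r
    have h1 : ⟪y, a⟫ = f (a, 0) := by
      simp [y, InnerProductSpace.toDual_symm_apply]
    have h2 : (a, r) = (a, (0 : ℝ)) + r • ((0 : E), (1 : ℝ)) := by simp
    rw [h2, map_add, map_smul, h1, smul_eq_mul, mul_comm r]
  rw [hf] at hfu
  have hus' : ∀ a r, (a, r) ∈ s → u < ⟪y, a⟫ + β * r := fun a r har => hf a r ▸ hus _ har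
  have hle : ∀ x b, (∀ a r, (a, r) ∈ s → ⟪x, a⟫ - r ≤ b) → S x ≤ b := fun x b hb =>
    (hS x).2 (by rintro _ ⟨⟨a, r⟩, har, rfl⟩; exact hb a r har)
  have hge : ∀ x a r, (a, r) ∈ s → ⟪x, a⟫ - r ≤ S x := fun x a r har => (hS x).1 ⟨(a, r), har, rfl⟩
  obtain ⟨⟨a₀, r₀⟩, h₀⟩ : s.Nonempty := (hS 0).nonempty.of_image
  have hβ : 0 ≤ β := by
    by_contra! hneg
    have hr := hus' a₀ (max r₀ ((u - ⟪y, a₀⟫) / β)) (hup _ _ _ h₀ (le_max_left _ _))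
    have := mul_le_mul_of_nonpos_left (le_max_right r₀ ((u - ⟪y, a₀⟫) / β)) hneg.le
    rw [mul_div_cancel₀ _ hneg.ne] at this
    linarith
  rcases hβ.eq_or_lt with hβ | hβ
  · rw [← hβ] at hfu hus'
    have hlt : 0 < u - ⟪y, p⟫ := by linarith
    set l : ℝ := (|c + S 0| + 1) / (u - ⟪y, p⟫)
    have hl : 0 ≤ l := by positivity
    have hl' : l * (u - ⟪y, p⟫) = |c + S 0| + 1 := div_mul_cancel₀ _ hlt.ne'
    have h1 : S (-(l • y)) ≤ S 0 - l * u := by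
      refine hle _ _ fun a r har => ?_
      have h2 := hge 0 a r har
      have h3 := mul_le_mul_of_nonneg_left (hus' a r har).le hl
      simp only [inner_neg_left, real_inner_smul_left, inner_zero_left] at h2 ⊢
      linarith
    have h4 := h (-(l • y))
    simp only [inner_neg_left, real_inner_smul_left] at h4
    linarith [le_abs_self (c + S 0)]
  · have h1 : S (-(β⁻¹ • y)) ≤ -(β⁻¹ * u) := by
      refine hle _ _ fun a r har => ?_
      have h3 := mul_le_mul_of_nonneg_left (hus' a r har).le (inv_nonneg.2 hβ.le)
      rw [mul_add, inv_mul_cancel_left₀ hβ.ne'] at h3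
      simp only [inner_neg_left, real_inner_smul_left]
      linarith
    have h4 := h (-(β⁻¹ • y))
    have h3 := mul_lt_mul_of_pos_left hfu (inv_pos.2 hβ)
    rw [mul_add, inv_mul_cancel_left₀ hβ.ne'] at h3
    simp only [inner_neg_left, real_inner_smul_left] at h4
    linarith

theorem convexOn_intervalIntegral {E : Type*} [NormedAddCommGroup E] [NormedSpace ℝ E]
    {G : ℝ → E → ℝ} (hG : Continuous (Function.uncurry G)) {a b : ℝ} (hab : a ≤ b)
    (hconv : ∀ s, ConvexOn ℝ Set.univ (G s)) :
    ConvexOn ℝ Set.univ fun p => ∫ s in a..b, G s p := by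
  have hint : ∀ p, IntervalIntegrable (fun s => G s p) MeasureTheory.volume a b := fun p =>
    (hG.comp (continuous_id.prodMk continuous_const)).intervalIntegrable a b
  refine ⟨convex_univ, fun x _ y _ m k hm hk hmk => ?_⟩
  simp only [smul_eq_mul]
  rw [← intervalIntegral.integral_const_mul, ← intervalIntegral.integral_const_mul,
    ← intervalIntegral.integral_add ((hint x).const_mul m) ((hint y).const_mul k)]
  exact intervalIntegral.integral_mono hab (hint _)
    (((hint x).const_mul m).add ((hint y).const_mul k))
    fun s => (hconv s).2 (Set.mem_univ x) (Set.mem_univ y) hm hk hmk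

theorem fenchel_coe_le_coe_iff {n : ℕ} {J : EuclideanSpace ℝ (Fin n) → ℝ}
    {p : EuclideanSpace ℝ (Fin n)} {r : ℝ} :
    fenchel (fun z => (J z : EReal)) p ≤ r ↔ ∀ z, ⟪z, p⟫ - J z ≤ r := by
  simp only [fenchel, iSup_le_iff, ← EReal.coe_sub, EReal.coe_le_coe_iff]

theorem fenchel_coe_ne_bot {n : ℕ} (J : EuclideanSpace ℝ (Fin n) → ℝ)
    (p : EuclideanSpace ℝ (Fin n)) : fenchel (fun z => (J z : EReal)) p ≠ ⊥ := by
  refine ne_bot_of_le_ne_bot (EReal.coe_ne_bot (⟪0, p⟫ - J 0)) ?_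
  rw [EReal.coe_sub]
  exact le_iSup (fun x => ((⟪x, p⟫ : ℝ) : EReal) - (J x : EReal)) 0

/-- If the conjugate `S` of `V + J*` is finite, with `V` convex and continuous, then `V + J*` is
dominated at `p` by every upper bound of `x ↦ ⟪x, p⟫ - S x`. -/
theorem fenchel_le_of_forall_inner_sub_le {n : ℕ} {V J S : EuclideanSpace ℝ (Fin n) → ℝ}
    (hV : Continuous V) (hconv : ConvexOn ℝ Set.univ V)
    (hS : ∀ x, (S x : EReal) = ⨆ p : EuclideanSpace ℝ (Fin n),
      (((⟪x, p⟫ - V p : ℝ) : EReal) - fenchel (fun z => (J z : EReal)) p))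
    {p : EuclideanSpace ℝ (Fin n)} {c : ℝ} (h : ∀ x, ⟪x, p⟫ - S x ≤ c) :
    fenchel (fun z => (J z : EReal)) p ≤ ((c - V p : ℝ) : EReal) := by
  rw [fenchel_coe_le_coe_iff]
  let s : Set (EuclideanSpace ℝ (Fin n) × ℝ) := {w | ∀ z, ⟪z, w.1⟫ - J z ≤ w.2 - V w.1}
  refine mem_of_forall_inner_sub_conjugate_le (s := s) ?_ ?_ ?_ (fun x => ⟨?_, ?_⟩) h
  · rintro ⟨a, r⟩ har ⟨b, r'⟩ hbr m k hm hk hmk z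
    have h1 := mul_le_mul_of_nonneg_left (har z) hm
    have h2 := mul_le_mul_of_nonneg_left (hbr z) hk
    have h3 := hconv.2 (Set.mem_univ a) (Set.mem_univ b) hm hk hmk
    simp only [Prod.fst_add, Prod.snd_add, Prod.smul_fst, Prod.smul_snd, inner_add_right,
      real_inner_smul_right, smul_eq_mul] at h1 h2 h3 ⊢
    have h4 : J z = m * J z + k * J z := by rw [← add_mul, hmk, one_mul]
    linarith
  · simp only [s, Set.ofPred_forall]
    exact isClosed_iInter fun z => isClosed_le (by fun_prop) (by fun_prop)
  · intro a r r' har hr z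
    have := har z
    dsimp only at this ⊢
    linarith
  · rintro _ ⟨⟨a, r⟩, har, rfl⟩
    have h1 := fenchel_coe_le_coe_iff.2 har
    rw [← EReal.coe_le_coe_iff, hS x]
    refine le_iSup_of_le a ?_
    refine le_trans (le_of_eq ?_) (EReal.sub_le_sub le_rfl h1)
    rw [← EReal.coe_sub]
    congr 1
    ring
  · intro b hb
    rw [← EReal.coe_le_coe_iff, hS x]
    refine iSup_le fun a => ?_
    induction hF : fenchel (fun z => (J z : EReal)) a with
    | bot => exact absurd hF (fenchel_coe_ne_bot J a)
    | top => simp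
    | coe f =>
      have h1 := hb ⟨(a, f + V a), fun z => by
        simpa using fenchel_coe_le_coe_iff.1 hF.le z, rfl⟩
      rw [← EReal.coe_sub, EReal.coe_le_coe_iff]
      dsimp only at h1
      linarith

/-- The generalized Hopf formula is a viscosity supersolution in the subdifferential
sense: if `S(x,t) = sup_p { ⟨x,p⟩ − ∫₀ᵗ H(s,p) ds − J*(p) }` is finite-valued, with `H`
continuous and convex in `p` and `J` convex, `t₀ > 0`, and `(p,q)` satisfies
`S(x,t) ≥ S(x₀,t₀) + ⟨p, x−x₀⟩ + q(t−t₀)` for all `(x,t) ∈ ℝ^n × [0,∞)`, then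
`q + H(t₀,p) ≥ 0`. -/
theorem stmt4 {n : ℕ} (H : ℝ → EuclideanSpace ℝ (Fin n) → ℝ)
    (J : EuclideanSpace ℝ (Fin n) → ℝ)
    (hHcont : ContinuousOn (fun q : ℝ × EuclideanSpace ℝ (Fin n) => H q.1 q.2)
      (Set.Ici 0 ×ˢ Set.univ))
    (hHconv : ∀ t : ℝ, 0 ≤ t → ConvexOn ℝ Set.univ (H t))
    (hJ : ConvexOn ℝ Set.univ J)
    (S : EuclideanSpace ℝ (Fin n) → ℝ → ℝ)
    (hS : ∀ x : EuclideanSpace ℝ (Fin n), ∀ t : ℝ, 0 ≤ t →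
      (S x t : EReal) = ⨆ p : EuclideanSpace ℝ (Fin n),
        (((⟪x, p⟫ - ∫ s in (0:ℝ)..t, H s p : ℝ) : EReal)
          - fenchel (fun z => (J z : EReal)) p))
    (t₀ : ℝ) (ht₀ : 0 < t₀) (x₀ p : EuclideanSpace ℝ (Fin n)) (q : ℝ)
    (hsub : ∀ x : EuclideanSpace ℝ (Fin n), ∀ t : ℝ, 0 ≤ t →
      S x₀ t₀ + ⟪p, x - x₀⟫ + q * (t - t₀) ≤ S x t) :
    0 ≤ q + H t₀ p := by
  let G : ℝ → EuclideanSpace ℝ (Fin n) → ℝ := fun s a => H (max s 0) a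
  have hG : Continuous (Function.uncurry G) :=
    hHcont.comp_continuous (f := fun w : ℝ × EuclideanSpace ℝ (Fin n) => (max w.1 0, w.2))
      (by fun_prop) fun w => ⟨Set.mem_Ici.2 (le_max_right _ _), Set.mem_univ _⟩
  have hGH : ∀ t, 0 ≤ t → ∀ a, ∫ s in (0:ℝ)..t, H s a = ∫ s in (0:ℝ)..t, G s a := by
    refine fun t ht a => intervalIntegral.integral_congr fun s hs => ?_
    rw [Set.uIcc_of_le ht] at hs
    simp [G, hs.1]
  have hVcont : ∀ t, Continuous fun a => ∫ s in (0:ℝ)..t, G s a := fun t =>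
    intervalIntegral.continuous_parametric_intervalIntegral_of_continuous'
      (f := fun a s => G s a) (hG.comp continuous_swap) 0 t
  have hbound : ∀ t, 0 ≤ t → fenchel (fun z => (J z : EReal)) p ≤
      ((⟪x₀, p⟫ - S x₀ t₀ - q * (t - t₀) - ∫ s in (0:ℝ)..t, G s p : ℝ) : EReal) := by
    intro t ht
    refine fenchel_le_of_forall_inner_sub_le (S := fun x => S x t) (hVcont t)
      (convexOn_intervalIntegral hG ht fun s => hHconv _ (le_max_right _ _)) (fun x => ?_)
      fun x => ?_
    · simp only [hS x t ht, hGH t ht]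
    · have h1 := hsub x t ht
      rw [inner_sub_right, real_inner_comm x p, real_inner_comm x₀ p] at h1
      linarith
  obtain ⟨f, hf⟩ : ∃ f : ℝ, fenchel (fun z => (J z : EReal)) p = f :=
    ⟨_, (EReal.coe_toReal (ne_top_of_le_ne_top (EReal.coe_ne_top _) (hbound t₀ ht₀.le))
      (fenchel_coe_ne_bot J p)).symm⟩
  have hlow : ⟪x₀, p⟫ - (∫ s in (0:ℝ)..t₀, G s p) - f ≤ S x₀ t₀ := by
    rw [← EReal.coe_le_coe_iff, hS x₀ t₀ ht₀.le, EReal.coe_sub, ← hf, ← hGH t₀ ht₀.le]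
    exact le_iSup (fun a => ((⟪x₀, a⟫ - ∫ s in (0:ℝ)..t₀, H s a : ℝ) : EReal)
      - fenchel (fun z => (J z : EReal)) a) p
  have hmax : IsLocalMax (fun t => q * t + ∫ s in (0:ℝ)..t, G s p) t₀ := by
    filter_upwards [Ioi_mem_nhds ht₀] with t ht
    have h1 := hbound t (le_of_lt ht)
    rw [hf, EReal.coe_le_coe_iff] at h1
    linarith
  have hGp : Continuous fun s => G s p := hG.comp (continuous_id.prodMk continuous_const)
  have hder := ((hasDerivAt_id t₀).const_mul q).add (hGp.integral_hasStrictDerivAt 0 t₀).hasDerivAt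
  have hzero := hmax.hasDerivAt_eq_zero hder
  simp only [G, max_eq_left ht₀.le, mul_one] at hzero
  exact hzero.ge
end

section
/- Let Φ : [0,∞) → ℝ^{m×n} and y : [0,∞) → ℝ^m be continuous, let M ∈ ℝ^{n×n} be symmetric positive definite, define P(t) = ( M + ∫₀ᵗ Φ(s)ᵀΦ(s) ds )⁻¹ and q(t) = P(t) ∫₀ᵗ Φ(s)ᵀ y(s) ds. Then q(0) = 0, q is differentiable on (0,∞), and q satisfies the Riccati ordinary differential equation q′(t) = −P(t)ᵀ Φ(t)ᵀ ( Φ(t) q(t) − y(t) ) for all t > 0. -/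
open Matrix

theorem hasDerivAt_integral_of_continuousOn_Ici {f : ℝ → ℝ} {a t : ℝ}
    (hf : ContinuousOn f (Set.Ici a)) (ht : a < t) :
    HasDerivAt (fun τ => ∫ s in a..τ, f s) (f t) t := by
  refine intervalIntegral.integral_hasDerivAt_right
    (hf.mono ?_).intervalIntegrable ?_ (hf.continuousAt (Ici_mem_nhds ht))
  · rw [Set.uIcc_of_le ht.le]
    exact Set.Icc_subset_Ici_self
  · exact (hf.mono Set.Ioi_subset_Ici_self).stronglyMeasurableAtFilter isOpen_Ioi t ht

section MatrixInverse

open scoped Matrix.Norms.Operator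

theorem Matrix.hasDerivAt_inv_apply {ι : Type*} [Fintype ι] [DecidableEq ι]
    {A : ℝ → Matrix ι ι ℝ} {A' : Matrix ι ι ℝ} {t : ℝ}
    (hA : ∀ i j, HasDerivAt (fun τ => A τ i j) (A' i j) t) (hu : IsUnit (A t)) (i j : ι) :
    HasDerivAt (fun τ => (A τ)⁻¹ i j) ((-((A t)⁻¹ * A' * (A t)⁻¹)) i j) t := by
  have hAt : HasDerivAt A A' t :=
    hasDerivAt_pi.2 fun i => hasDerivAt_pi.2 fun j => hA i j
  obtain ⟨u, hu⟩ := hu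
  have hinv : HasFDerivAt Ring.inverse
      (-ContinuousLinearMap.mulLeftRight ℝ (Matrix ι ι ℝ) ↑u⁻¹ ↑u⁻¹) (A t) := by
    rw [← hu]
    exact hasFDerivAt_ringInverse u
  have hcomp := hinv.comp_hasDerivAt t hAt
  have hentry := hasDerivAt_pi.1 (hasDerivAt_pi.1 hcomp i) j
  have huinv : (A t)⁻¹ = ↑u⁻¹ := by
    rw [Matrix.nonsing_inv_eq_ringInverse, ← hu, Ring.inverse_unit]
  simp only [Matrix.nonsing_inv_eq_ringInverse] at huinv ⊢
  rw [huinv]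
  exact hentry

end MatrixInverse

theorem Matrix.posSemidef_integral_transpose_mul_self {m n : Type*} [Fintype m] [Fintype n]
    {Φ : ℝ → Matrix m n ℝ} {a t : ℝ} (hΦ : ContinuousOn Φ (Set.Icc a t)) (hat : a ≤ t) :
    (Matrix.of fun i j => ∫ s in a..t, ((Φ s)ᵀ * Φ s) i j).PosSemidef := by
  have hcont : ContinuousOn (fun s => (Φ s)ᵀ * Φ s) (Set.Icc a t) := by fun_prop
  have hint : ∀ i j, IntervalIntegrable (fun s => ((Φ s)ᵀ * Φ s) i j) MeasureTheory.volume a t := by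
    intro i j
    apply ContinuousOn.intervalIntegrable
    rw [Set.uIcc_of_le hat]
    exact continuousOn_pi.1 (continuousOn_pi.1 hcont i) j
  refine Matrix.PosSemidef.of_dotProduct_mulVec_nonneg ?_ fun x => ?_
  · ext i j
    simp [Matrix.mul_apply, mul_comm]
  · have hquad : star x ⬝ᵥ ((Matrix.of fun i j => ∫ s in a..t, ((Φ s)ᵀ * Φ s) i j) *ᵥ x)
        = ∫ s in a..t, x ⬝ᵥ (((Φ s)ᵀ * Φ s) *ᵥ x) := by
      simp only [dotProduct, Matrix.mulVec, Matrix.of_apply, star_trivial]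
      have hsum : ∀ i, IntervalIntegrable (fun s => ∑ j, ((Φ s)ᵀ * Φ s) i j * x j)
          MeasureTheory.volume a t := fun i => by
        simpa only [Finset.sum_fn] using
          IntervalIntegrable.sum Finset.univ fun j _ => (hint i j).mul_const (x j)
      rw [intervalIntegral.integral_finsetSum fun i _ => (hsum i).const_mul (x i)]
      refine Finset.sum_congr rfl fun i _ => ?_
      rw [intervalIntegral.integral_const_mul, intervalIntegral.integral_finsetSum fun j _ =>
        (hint i j).mul_const (x j)]
      simp only [intervalIntegral.integral_mul_const]
    rw [hquad]
    refine intervalIntegral.integral_nonneg hat fun s _ => ?_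
    rw [← Matrix.mulVec_mulVec, Matrix.dotProduct_mulVec, Matrix.vecMul_transpose]
    exact Finset.sum_nonneg fun i _ => mul_self_nonneg _

/-- With `P(t) = (M + ∫₀ᵗ Φ(s)ᵀΦ(s) ds)⁻¹` and `q(t) = P(t) ∫₀ᵗ Φ(s)ᵀy(s) ds`, we have
`q(0) = 0`, `q` is differentiable on `(0,∞)` (entrywise), and `q` satisfies the Riccati
ODE `q′(t) = −P(t)ᵀΦ(t)ᵀ(Φ(t)q(t) − y(t))` for all `t > 0`. -/
theorem stmt15 {m n : ℕ} (Φ : ℝ → Matrix (Fin m) (Fin n) ℝ) (y : ℝ → Fin m → ℝ)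
    (hΦ : ContinuousOn Φ (Set.Ici 0)) (hy : ContinuousOn y (Set.Ici 0))
    (M : Matrix (Fin n) (Fin n) ℝ) (hMs : M.IsSymm) (hMpd : M.PosDef)
    (P : ℝ → Matrix (Fin n) (Fin n) ℝ)
    (hP : ∀ t, P t = (M + Matrix.of fun i j => ∫ s in (0:ℝ)..t, ((Φ s)ᵀ * Φ s) i j)⁻¹)
    (q : ℝ → Fin n → ℝ)
    (hq : ∀ t, q t = (P t).mulVec fun i => ∫ s in (0:ℝ)..t, (Φ s)ᵀ.mulVec (y s) i) :
    q 0 = 0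
    ∧ (∀ t : ℝ, 0 < t → ∀ i : Fin n,
        HasDerivAt (fun τ => q τ i)
          ((-(P t)ᵀ.mulVec ((Φ t)ᵀ.mulVec ((Φ t).mulVec (q t) - y t))) i) t) := by
  refine ⟨by simp [hq, ← Pi.zero_def], fun t ht i => ?_⟩
  let A : ℝ → Matrix (Fin n) (Fin n) ℝ := fun t =>
    M + Matrix.of fun i j => ∫ s in (0:ℝ)..t, ((Φ s)ᵀ * Φ s) i j
  have hpd : (A t).PosDef := hMpd.add_posSemidef
    (Matrix.posSemidef_integral_transpose_mul_self (hΦ.mono Set.Icc_subset_Ici_self) ht.le)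
  have hPA : ∀ t, P t = (A t)⁻¹ := hP
  have hPt : (P t)ᵀ = P t := by
    rw [hPA]
    exact hpd.isHermitian.inv
  have hΦΦ : ContinuousOn (fun s => (Φ s)ᵀ * Φ s) (Set.Ici 0) := by fun_prop
  have hΦy : ContinuousOn (fun s => (Φ s)ᵀ *ᵥ y s) (Set.Ici 0) := by fun_prop
  have hAd : ∀ i j, HasDerivAt (fun τ => A τ i j) (((Φ t)ᵀ * Φ t) i j) t := fun i j =>
    (hasDerivAt_integral_of_continuousOn_Ici
      (continuousOn_pi.1 (continuousOn_pi.1 hΦΦ i) j) ht).const_add (M i j)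
  have hPd := Matrix.hasDerivAt_inv_apply hAd hpd.isUnit
  have hbd : ∀ j, HasDerivAt (fun τ => ∫ s in (0:ℝ)..τ, ((Φ s)ᵀ *ᵥ y s) j)
      (((Φ t)ᵀ *ᵥ y t) j) t := fun j =>
    hasDerivAt_integral_of_continuousOn_Ici (continuousOn_pi.1 hΦy j) ht
  have hqd := HasDerivAt.fun_sum (u := Finset.univ) fun j _ => (hPd i j).mul (hbd j)
  simp only [← hPA] at hqd
  have hval : (-(P t)ᵀ.mulVec ((Φ t)ᵀ.mulVec ((Φ t).mulVec (q t) - y t))) i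
      = ((-(P t * ((Φ t)ᵀ * Φ t) * P t)) *ᵥ
          fun j => ∫ s in (0:ℝ)..t, ((Φ s)ᵀ *ᵥ y s) j) i + (P t *ᵥ ((Φ t)ᵀ *ᵥ y t)) i := by
    rw [hPt, ← Pi.add_apply, Matrix.neg_mulVec, ← Matrix.mulVec_mulVec, ← hq]
    simp only [Matrix.mulVec_sub, Matrix.mulVec_mulVec]
    simp [sub_eq_add_neg, add_comm]
  rw [Finset.sum_add_distrib] at hqd
  rw [hval, show (fun τ => q τ i) = _ from funext fun τ => congrFun (hq τ) i]
  exact hqd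
end
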